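/- arXiv:1801.00072 — 7 statements merged into one kernel-verified Lean document; each statement's English description precedes it below -/
import Mathlib

section
/- Let f, g_1, …, g_m : ℝⁿ → ℝⁿ be smooth vector fields and ρ : ℝⁿ → ℝ^d a smooth map with zero set N = ρ⁻¹(0). Assume that for every constant vector c ∈ ℝ^m, every T > 0, and every differentiable curve x : [0,T] → ℝⁿ satisfying x'(t) = f(x(t)) + Σ_{j=1}^m c_j·g_j(x(t)) for all t ∈ [0,T] and x(0) ∈ N, one has x(t) ∈ N for all t ∈ [0,T]. Then for every p ∈ N it holds that Dρ(p)(f(p)) = 0 and Dρ(p)(g_j(p)) = 0 for every j = 1, …, m. -/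
/-- Forward direction of Theorem 1.7: if the zero set `N` of `ρ` is invariant under all
constant controls of the affine control system `ẋ = f(x) + ∑ uⱼ gⱼ(x)`, then `Dρ(p)`
annihilates `f(p)` and each `gⱼ(p)` at every point `p ∈ N`. -/
theorem invariant_implies_annihilated
    (n m d : ℕ) (f : (Fin n → ℝ) → (Fin n → ℝ))
    (g : Fin m → (Fin n → ℝ) → (Fin n → ℝ))
    (ρ : (Fin n → ℝ) → (Fin d → ℝ))
    (hf : ContDiff ℝ (⊤ : ℕ∞) f) (hg : ∀ j, ContDiff ℝ (⊤ : ℕ∞) (g j)) (hρ : ContDiff ℝ (⊤ : ℕ∞) ρ)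
    (N : Set (Fin n → ℝ)) (hN : N = ρ ⁻¹' {0})
    (hinv : ∀ c : Fin m → ℝ, ∀ T : ℝ, 0 < T → ∀ x : ℝ → (Fin n → ℝ),
      (∀ t ∈ Set.Icc (0:ℝ) T, HasDerivAt x (f (x t) + ∑ j, c j • g j (x t)) t) →
      x 0 ∈ N → ∀ t ∈ Set.Icc (0:ℝ) T, x t ∈ N) :
    ∀ p ∈ N, fderiv ℝ ρ p (f p) = 0 ∧ ∀ j, fderiv ℝ ρ p (g j p) = 0 := by
  intro p hp
  have key : ∀ c : Fin m → ℝ, fderiv ℝ ρ p (f p + ∑ j, c j • g j p) = 0 := by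
    intro c
    have hF : ContDiff ℝ 1 (fun y => f y + ∑ j, c j • g j y) := by
      refine (hf.of_le (by exact_mod_cast le_top)).add (ContDiff.sum fun j _ => ?_)
      have h : ContDiff ℝ 1 (g j) := (hg j).of_le (by exact_mod_cast le_top)
      exact h.const_smul (c j)
    obtain ⟨x, hx0, ε, hε, hx⟩ :=
      hF.contDiffAt (x := p) |>.exists_forall_mem_closedBall_exists_eq_forall_mem_Ioo_hasDerivAt₀ 0
    have hmem := hinv c (ε/2) (by linarith) x
      (fun t ht => hx t ⟨by linarith [ht.1], by linarith [ht.2]⟩) (by rw [hx0]; exact hp)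
    have h0 := hx 0 ⟨by linarith, by linarith⟩
    have hρ' : HasFDerivAt ρ (fderiv ℝ ρ p) (x 0) := by
      rw [hx0]; exact (hρ.differentiable (by simp) p).hasFDerivAt
    have h1 := (hρ'.comp_hasDerivAt (0:ℝ) h0).hasDerivWithinAt (s := Set.Icc 0 (ε/2))
    have h2 : HasDerivWithinAt (ρ ∘ x) 0 (Set.Icc 0 (ε/2)) 0 := by
      refine (hasDerivWithinAt_const (0:ℝ) (Set.Icc 0 (ε/2)) (0 : Fin d → ℝ)).congr ?_ ?_
      · intro t ht
        have := hmem t ht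
        rw [hN] at this
        exact this
      · have := hmem 0 ⟨le_rfl, by linarith⟩
        rw [hN] at this
        exact this
    have hu := (uniqueDiffOn_Icc (show (0:ℝ) < ε/2 by linarith)) 0 ⟨le_rfl, by linarith⟩
    have := hu.eq_deriv _ h1 h2
    rwa [hx0] at this
  have k0 : fderiv ℝ ρ p (f p) = 0 := by simpa using key 0
  refine ⟨k0, fun j => ?_⟩
  have := key (Pi.single j 1)
  rw [map_add, k0, zero_add] at this
  simpa [Pi.single_apply, ite_smul] using this
end

section
/- Let v : ℝⁿ → ℝⁿ be a smooth vector field and ρ : ℝⁿ → ℝ^d a smooth map such that the total derivative Dρ(x) : ℝⁿ → ℝ^d is surjective for every x in some open neighborhood of N = ρ⁻¹(0), and such that Dρ(x)(v(x)) = 0 for every x ∈ N. Then for every T > 0 and every differentiable curve x : [0,T] → ℝⁿ with x'(t) = v(x(t)) for all t ∈ [0,T] and ρ(x(0)) = 0, one has ρ(x(t)) = 0 for all t ∈ [0,T]. -/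
open Set Filter Topology Metric in
theorem local_bound_aux {n d : ℕ} (w : (Fin n → ℝ) → (Fin d → ℝ)) (ρ : (Fin n → ℝ) → (Fin d → ℝ))
    (p : Fin n → ℝ) (hw : ContDiffAt ℝ 1 w p) (hρ : ContDiffAt ℝ 1 ρ p)
    (hs : Function.Surjective (fderiv ℝ ρ p)) (hp : ρ p = 0)
    (h0 : ∀ y, ρ y = 0 → w y = 0) :
    ∃ K : ℝ, ∀ᶠ x in 𝓝 p, ‖w x‖ ≤ K * ‖ρ x‖ := by
  obtain ⟨L, t, ht, hL⟩ := hw.exists_lipschitzOnWith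
  obtain ⟨g, hg⟩ := (fderiv ℝ ρ p).exists_nonlinearRightInverse_of_surjective
    (LinearMap.range_eq_top.2 hs)
  have hstr : HasStrictFDerivAt ρ (fderiv ℝ ρ p) p := hρ.hasStrictFDerivAt one_ne_zero
  set c : NNReal := g.nnnorm⁻¹ / 2 with hc
  have hi : 0 < g.nnnorm⁻¹ := inv_pos.2 hg
  have hcpos : 0 < c := half_pos hi
  obtain ⟨s, hsn, happ⟩ := hstr.approximates_deriv_on_nhds (Or.inr hcpos)
  obtain ⟨r, hr, hball⟩ := Metric.mem_nhds_iff.1 (inter_mem ht hsn)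
  have hcR : (0:ℝ) < c := hcpos
  have hcoe : ((g.nnnorm⁻¹ : NNReal) : ℝ) - c = c := by
    rw [hc]; push_cast; ring
  refine ⟨L * (c:ℝ)⁻¹, ?_⟩
  have hcont : Tendsto (fun x => (c:ℝ)⁻¹ * ‖ρ x‖) (𝓝 p) (𝓝 0) := by
    have := (hρ.continuousAt.norm.const_mul (c:ℝ)⁻¹ : _)
    simpa [ContinuousAt, hp] using this
  have e1 : ∀ᶠ x in 𝓝 p, (c:ℝ)⁻¹ * ‖ρ x‖ < r / 2 := hcont.eventually_lt_const (half_pos hr)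
  filter_upwards [e1, Metric.ball_mem_nhds p (half_pos hr)] with x hx1 hx2
  have hsub : closedBall x ((c:ℝ)⁻¹ * ‖ρ x‖) ⊆ t ∩ s := by
    intro y hy
    apply hball
    rw [mem_ball] at hx2 ⊢
    rw [mem_closedBall] at hy
    linarith [dist_triangle y x p]
  have hsurj := happ.surjOn_closedBall_of_nonlinearRightInverse g (b := x)
    (ε := (c:ℝ)⁻¹ * ‖ρ x‖) (by positivity) (fun y hy => (hsub hy).2)
  obtain ⟨y, hy, hy0⟩ := hsurj (a := 0) (by
    rw [mem_closedBall, dist_zero_left, ← NNReal.coe_inv, hcoe, mul_inv_cancel_left₀ hcR.ne'])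
  have hxt : x ∈ t := (hsub (mem_closedBall_self (by positivity))).1
  have h := hL.dist_le_mul x hxt y (hsub hy).1
  rw [h0 y hy0, dist_zero_right, dist_comm] at h
  rw [mul_assoc]
  exact h.trans (mul_le_mul_of_nonneg_left (mem_closedBall.1 hy) L.2)

/-- A level set `N = ρ⁻¹(0)` of a non-degenerate smooth map `ρ` (i.e. `Dρ` surjective on a
neighborhood of `N`) is invariant under the flow of any smooth vector field `v` tangent to it. -/
theorem levelSet_invariant_of_tangent
    (n d : ℕ) (v : (Fin n → ℝ) → (Fin n → ℝ)) (ρ : (Fin n → ℝ) → (Fin d → ℝ))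
    (hv : ContDiff ℝ (⊤ : ℕ∞) v) (hρ : ContDiff ℝ (⊤ : ℕ∞) ρ)
    (hnd : ∃ U : Set (Fin n → ℝ), IsOpen U ∧ ρ ⁻¹' {0} ⊆ U ∧
      ∀ x ∈ U, Function.Surjective (fderiv ℝ ρ x))
    (htan : ∀ x ∈ ρ ⁻¹' {0}, fderiv ℝ ρ x (v x) = 0) :
    ∀ T : ℝ, 0 < T → ∀ x : ℝ → (Fin n → ℝ),
      (∀ t ∈ Set.Icc (0:ℝ) T, HasDerivAt x (v (x t)) t) →
      ρ (x 0) = 0 → ∀ t ∈ Set.Icc (0:ℝ) T, ρ (x t) = 0 := by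
  obtain ⟨U, hU, hNU, hsur⟩ := hnd
  intro T hT x hx hx0
  have hw : ContDiff ℝ 1 (fun y => fderiv ℝ ρ y (v y)) :=
    (hρ.fderiv_right (m := 1) (by norm_cast)).clm_apply (hv.of_le (by norm_cast))
  have hρ1 : ContDiff ℝ 1 ρ := hρ.of_le (by norm_cast)
  have hd : ∀ t ∈ Set.Icc (0:ℝ) T,
      HasDerivAt (fun s => ρ (x s)) (fderiv ℝ ρ (x t) (v (x t))) t := fun t ht =>
    ((hρ1.differentiable one_ne_zero (x t)).hasFDerivAt).comp_hasDerivAt t (hx t ht)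
  have hc : ContinuousOn (fun s => ρ (x s)) (Set.Icc 0 T) :=
    fun t ht => (hd t ht).continuousAt.continuousWithinAt
  have key : Set.Icc 0 T ⊆ {t | ρ (x t) = 0} := by
    apply IsClosed.Icc_subset_of_forall_mem_nhdsWithin
    · rw [Set.inter_comm]
      exact hc.preimage_isClosed_of_isClosed isClosed_Icc (isClosed_singleton (x := 0))
    · exact hx0
    · rintro t ⟨ht0, ht⟩
      have ht' : t ∈ Set.Icc 0 T := ⟨ht.1, ht.2.le⟩
      obtain ⟨K, hK⟩ := local_bound_aux _ ρ (x t) hw.contDiffAt hρ1.contDiffAt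
        (hsur _ (hNU ht0)) ht0 (fun y hy => htan y hy)
      obtain ⟨δ, hδ, hb⟩ := Metric.eventually_nhds_iff.1 ((hx t ht').continuousAt.eventually hK)
      set b := min (t + δ / 2) T with hbdef
      have htb : t < b := lt_min (by linarith) ht.2
      have hbT : b ≤ T := min_le_right _ _
      have hbδ : b ≤ t + δ / 2 := min_le_left _ _
      have hsub : Set.Icc t b ⊆ Set.Icc 0 T := Set.Icc_subset_Icc ht.1 hbT
      have hz := eq_zero_of_abs_deriv_le_mul_abs_self_of_eq_zero_right (K := K) (hc.mono hsub)
        (fun s hs => (hd s (hsub (Set.Ico_subset_Icc_self hs))).hasDerivWithinAt) ht0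
        (fun s hs => hb (by
          rw [Real.dist_eq, abs_of_nonneg (by linarith [hs.1])]; linarith [hs.2]))
      exact Filter.mem_of_superset (Icc_mem_nhdsGT htb) hz
  exact fun t ht => key ht
end

section
/- Let f, g_1, …, g_m : ℝⁿ → ℝⁿ be smooth vector fields and ρ = (ρ¹, …, ρ^d) : ℝⁿ → ℝ^d a smooth non-degenerate map with zero set N = ρ⁻¹(0). Then N is invariant under controls of the affine control system ẋ = f(x) + Σ_{j=1}^m u_j g_j(x) if and only if for every p ∈ N one has Dρ(p)(f(p)) = 0 and Dρ(p)(g_j(p)) = 0 for every j = 1, …, m. -/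
/-- `x` is a solution on `[0,T]` of the affine control system `ẋ = f(x) + ∑ⱼ uⱼ gⱼ(x)` with a
piecewise constant control `u`: `x` is continuous on `[0,T]` and there is a partition
`0 = τ₀ < τ₁ < ⋯ < τ_k = T` such that `u` is constant on the interior of each subinterval and
`x` satisfies the differential equation at every point of these interiors. -/
def IsPWConstSol (n m : ℕ) (f : (Fin n → ℝ) → (Fin n → ℝ))
    (g : Fin m → (Fin n → ℝ) → (Fin n → ℝ))
    (T : ℝ) (u : ℝ → Fin m → ℝ) (x : ℝ → (Fin n → ℝ)) : Prop :=
  ContinuousOn x (Set.Icc 0 T) ∧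
  ∃ k : ℕ, ∃ τ : Fin (k + 1) → ℝ, τ 0 = 0 ∧ τ (Fin.last k) = T ∧ StrictMono τ ∧
    ∀ i : Fin k,
      (∃ c : Fin m → ℝ, ∀ s ∈ Set.Ioo (τ i.castSucc) (τ i.succ), u s = c) ∧
      ∀ s ∈ Set.Ioo (τ i.castSucc) (τ i.succ),
        HasDerivAt x (f (x s) + ∑ j, u s j • g j (x s)) s

open Set Filter Topology in
lemma aux_bound {n d : ℕ} (ρ : (Fin n → ℝ) → (Fin d → ℝ)) (h : (Fin n → ℝ) → (Fin d → ℝ))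
    (hρ : ContDiff ℝ 1 ρ) (hh : ContDiff ℝ 1 h) (hz : ∀ p, ρ p = 0 → h p = 0)
    (p : Fin n → ℝ) (hp : ρ p = 0) (hs : Function.Surjective (fderiv ℝ ρ p)) :
    ∃ K : ℝ, ∀ᶠ x in 𝓝 p, ‖h x‖ ≤ K * ‖ρ x‖ := by
  have hst : HasStrictFDerivAt ρ (fderiv ℝ ρ p) p :=
    hρ.contDiffAt.hasStrictFDerivAt one_ne_zero
  have hr : (fderiv ℝ ρ p).range = ⊤ := LinearMap.range_eq_top.2 hs
  let R := (fderiv ℝ ρ p).nonlinearRightInverseOfSurjective hr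
  have hR : 0 < R.nnnorm := ContinuousLinearMap.nonlinearRightInverseOfSurjective_nnnorm_pos _ hr
  set c : NNReal := R.nnnorm⁻¹ / 2 with hc
  have hcpos : 0 < c := by rw [hc]; positivity
  obtain ⟨s, hs, hA⟩ := hst.approximates_deriv_on_nhds (Or.inr hcpos)
  obtain ⟨L, t, ht, hL⟩ := (hh.contDiffAt (x := p)).exists_lipschitzOnWith
  obtain ⟨r, hr0, hball⟩ := Metric.mem_nhds_iff.1 (inter_mem hs ht)
  have hcR : ((R.nnnorm : ℝ)⁻¹ - c) = c := by
    rw [hc]; push_cast; ring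
  have hc0 : (0:ℝ) < c := by exact_mod_cast hcpos
  refine ⟨L * (c:ℝ)⁻¹, ?_⟩
  have h1 : ∀ᶠ x in 𝓝 p, dist x p < r / 2 := Metric.ball_mem_nhds p (by positivity)
  have h2 : ∀ᶠ x in 𝓝 p, ‖ρ x‖ < c * (r / 2) := by
    have : Tendsto (fun x => ‖ρ x‖) (𝓝 p) (𝓝 ‖ρ p‖) := hρ.continuous.norm.continuousAt
    rw [hp, norm_zero] at this
    exact this.eventually_lt_const (by positivity)
  filter_upwards [h1, h2] with x hx1 hx2
  have he : (c:ℝ)⁻¹ * ‖ρ x‖ < r / 2 := by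
    rw [inv_mul_lt_iff₀ hc0]; exact hx2
  have hsub : Metric.closedBall x ((c:ℝ)⁻¹ * ‖ρ x‖) ⊆ Metric.ball p r := by
    intro y hy
    rw [Metric.mem_closedBall] at hy
    rw [Metric.mem_ball]
    linarith [dist_triangle y x p]
  have hsurj := hA.surjOn_closedBall_of_nonlinearRightInverse R
    (b := x) (ε := (c:ℝ)⁻¹ * ‖ρ x‖) (by positivity) (fun y hy => (hball (hsub hy)).1)
  rw [hcR, mul_inv_cancel_left₀ hc0.ne'] at hsurj
  obtain ⟨y, hy, hy0⟩ := hsurj (show (0 : Fin d → ℝ) ∈ _ by simp)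
  have hxt : x ∈ t := (hball (by rw [Metric.mem_ball]; linarith)).2
  have hyt : y ∈ t := (hball (hsub hy)).2
  have := hL.dist_le_mul x hxt y hyt
  rw [hz y hy0, dist_zero_right] at this
  rw [Metric.mem_closedBall, dist_comm] at hy
  calc ‖h x‖ ≤ L * dist x y := this
    _ ≤ L * ((c:ℝ)⁻¹ * ‖ρ x‖) := by gcongr
    _ = _ := by ring

open Set Filter Topology in
lemma aux_interval {n d : ℕ} (ρ : (Fin n → ℝ) → (Fin d → ℝ)) (F : (Fin n → ℝ) → (Fin n → ℝ))
    (hρ : ContDiff ℝ 2 ρ) (hF : ContDiff ℝ 1 F)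
    (hz : ∀ p, ρ p = 0 → fderiv ℝ ρ p (F p) = 0)
    (hs : ∀ p, ρ p = 0 → Function.Surjective (fderiv ℝ ρ p))
    (a b : ℝ) (x : ℝ → (Fin n → ℝ)) (hx : ContinuousOn x (Icc a b))
    (hd : ∀ s ∈ Ioo a b, HasDerivAt x (F (x s)) s) (ha : ρ (x a) = 0) :
    ∀ t ∈ Icc a b, ρ (x t) = 0 := by
  have hρ1 : ContDiff ℝ 1 ρ := hρ.of_le (by norm_num)
  have hh : ContDiff ℝ 1 (fun p => fderiv ℝ ρ p (F p)) :=
    (hρ.fderiv_right (m := 1) (by norm_num)).clm_apply hF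
  have hρx : ContinuousOn (fun t => ρ (x t)) (Icc a b) := hρ.continuous.comp_continuousOn hx
  -- right derivatives
  have hright : ∀ s ∈ Ico a b, HasDerivWithinAt x (F (x s)) (Ici s) s := by
    intro s hs
    rcases eq_or_lt_of_le hs.1 with rfl | h
    · have hcw : ContinuousWithinAt x (Ioo a b) a :=
        (hx a (left_mem_Icc.2 hs.2.le)).mono Ioo_subset_Icc_self
      have hmem : Ioo a b ∈ 𝓝[>] a := Ioo_mem_nhdsGT hs.2
      refine hasDerivWithinAt_Ici_of_tendsto_deriv (s := Ioo a b)
        (fun s hs => (hd s hs).differentiableAt.differentiableWithinAt) hcw hmem ?_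
      have : Tendsto (fun t => F (x t)) (𝓝[>] a) (𝓝 (F (x a))) := by
        have h1 : Tendsto x (𝓝[>] a) (𝓝 (x a)) := by
          rw [← nhdsWithin_Ioo_eq_nhdsGT hs.2]; exact hcw
        exact (hF.continuous.tendsto _).comp h1
      refine this.congr' ?_
      filter_upwards [hmem] with t ht using (hd t ht).deriv.symm
    · exact (hd s ⟨h, hs.2⟩).hasDerivWithinAt
  have key : Icc a b ⊆ {t | ρ (x t) = 0} := by
    apply IsClosed.Icc_subset_of_forall_mem_nhdsWithin
    · rw [inter_comm]
      exact hρx.preimage_isClosed_of_isClosed isClosed_Icc isClosed_singleton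
    · exact ha
    · rintro t ⟨ht0, ht⟩
      have ht0 : ρ (x t) = 0 := ht0
      obtain ⟨K, hK⟩ := aux_bound ρ _ hρ1 hh hz (x t) ht0 (hs _ ht0)
      have hcx : Tendsto x (𝓝[≥] t) (𝓝 (x t)) := by
        rw [← nhdsWithin_Icc_eq_nhdsGE ht.2]
        exact (hx t ⟨ht.1, ht.2.le⟩).mono (Icc_subset_Icc_left ht.1)
      have hev := hcx.eventually hK
      obtain ⟨e, he, hsub⟩ := (mem_nhdsGE_iff_exists_Ico_subset' ht.2).1 hev
      have he : t < e := he
      have hte : t < min e b := lt_min he ht.2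
      have hg := eq_zero_of_abs_deriv_le_mul_abs_self_of_eq_zero_right
        (f := fun t => ρ (x t)) (f' := fun t => fderiv ℝ ρ (x t) (F (x t))) (K := K)
        (a := t) (b := min e b)
        (hρx.mono (Icc_subset_Icc ht.1 (min_le_right _ _)))
        (fun s hs => by
          have h1 := hright s ⟨ht.1.trans hs.1, hs.2.trans_le (min_le_right _ _)⟩
          have h2 : HasFDerivAt ρ (fderiv ℝ ρ (x s)) (x s) :=
            (hρ1.differentiable one_ne_zero _).hasFDerivAt
          exact h2.comp_hasDerivWithinAt s h1)
        ht0
        (fun s hs => hsub ⟨hs.1, hs.2.trans_le (min_le_left _ _)⟩)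
      filter_upwards [Ioo_mem_nhdsGT hte] with s hs using hg s ⟨hs.1.le, hs.2.le⟩
  exact key

open Set Filter Topology in
lemma aux_tangent {n m d : ℕ} (f : (Fin n → ℝ) → (Fin n → ℝ))
    (g : Fin m → (Fin n → ℝ) → (Fin n → ℝ))
    (ρ : (Fin n → ℝ) → (Fin d → ℝ))
    (hρ : Differentiable ℝ ρ) (c : Fin m → ℝ)
    (hF : ContDiff ℝ 1 (fun p => f p + ∑ j, c j • g j p))
    (H : ∀ T : ℝ, 0 < T → ∀ u : ℝ → Fin m → ℝ, ∀ x : ℝ → (Fin n → ℝ),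
        IsPWConstSol n m f g T u x → ρ (x 0) = 0 → ∀ t ∈ Set.Icc (0:ℝ) T, ρ (x t) = 0)
    (p : Fin n → ℝ) (hp : ρ p = 0) : fderiv ℝ ρ p (f p + ∑ j, c j • g j p) = 0 := by
  obtain ⟨x, hx0, e, he, hx⟩ :=
    (hF.contDiffAt (x := p)).exists_forall_mem_closedBall_exists_eq_forall_mem_Ioo_hasDerivAt₀ 0
  have hT : 0 < e / 2 := by positivity
  have hz := H (e / 2) hT (fun _ => c) x
    ⟨fun t ht => (hx t ⟨by linarith [ht.1], by linarith [ht.2]⟩).continuousAt.continuousWithinAt,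
      1, ![0, e / 2], by simp, by simp [Fin.last], by
        rw [Fin.strictMono_iff_lt_succ]; intro i; fin_cases i; simpa using he, by
        intro i
        fin_cases i
        refine ⟨⟨c, fun _ _ => rfl⟩, fun s hs => hx s ?_⟩
        simp at hs
        exact ⟨by linarith [hs.1], by linarith [hs.2]⟩⟩ (by rw [hx0, hp])
  have h1 := hx 0 ⟨by linarith, by linarith⟩
  have h2 : HasFDerivAt ρ (fderiv ℝ ρ (x 0)) (x 0) := (hρ _).hasFDerivAt
  have h3 := (h2.comp_hasDerivAt (0:ℝ) h1).hasDerivWithinAt (s := Icc 0 (e / 2))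
  have h4 : HasDerivWithinAt (ρ ∘ x) 0 (Icc 0 (e / 2)) 0 :=
    (hasDerivWithinAt_const (0:ℝ) _ (0 : Fin d → ℝ)).congr hz (hz 0 ⟨le_rfl, hT.le⟩)
  have := (uniqueDiffOn_Icc hT 0 ⟨le_rfl, hT.le⟩).eq_deriv _ h3 h4
  rwa [hx0] at this

/-- Theorem 1.7: the zero set `N = ρ⁻¹(0)` of a smooth non-degenerate map `ρ` is invariant under
controls of the affine control system `ẋ = f(x) + ∑ⱼ uⱼ gⱼ(x)` if and only if `ρ` is a system of
generalized first integrals of the distribution spanned by `f, g₁, …, g_m`, i.e. `Dρ(p)`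
annihilates `f(p)` and every `gⱼ(p)` at each point `p` of `N`. -/
theorem invariant_iff_generalizedFirstIntegral
    (n m d : ℕ) (f : (Fin n → ℝ) → (Fin n → ℝ))
    (g : Fin m → (Fin n → ℝ) → (Fin n → ℝ))
    (ρ : (Fin n → ℝ) → (Fin d → ℝ))
    (hf : ContDiff ℝ (⊤ : ℕ∞) f) (hg : ∀ j, ContDiff ℝ (⊤ : ℕ∞) (g j)) (hρ : ContDiff ℝ (⊤ : ℕ∞) ρ)
    (hnd : ∃ U : Set (Fin n → ℝ), IsOpen U ∧ ρ ⁻¹' {0} ⊆ U ∧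
      ∀ x ∈ U, Function.Surjective (fderiv ℝ ρ x)) :
    (∀ T : ℝ, 0 < T → ∀ u : ℝ → Fin m → ℝ, ∀ x : ℝ → (Fin n → ℝ),
        IsPWConstSol n m f g T u x → ρ (x 0) = 0 → ∀ t ∈ Set.Icc (0:ℝ) T, ρ (x t) = 0) ↔
    (∀ p, ρ p = 0 → fderiv ℝ ρ p (f p) = 0 ∧ ∀ j, fderiv ℝ ρ p (g j p) = 0) := by
  have h1 : ((1:ℕ∞) : WithTop ℕ∞) ≤ ((⊤ : ℕ∞) : WithTop ℕ∞) := by exact_mod_cast le_top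
  have h2 : ((2:ℕ∞) : WithTop ℕ∞) ≤ ((⊤ : ℕ∞) : WithTop ℕ∞) := by exact_mod_cast le_top
  have hF : ∀ c : Fin m → ℝ, ContDiff ℝ 1 (fun p => f p + ∑ j, c j • g j p) := fun c =>
    (hf.of_le h1).add (ContDiff.sum fun j _ => ((hg j).of_le h1).const_smul (c j))
  obtain ⟨U, -, hU, hsurj⟩ := hnd
  have hs : ∀ p, ρ p = 0 → Function.Surjective (fderiv ℝ ρ p) := fun p hp => hsurj p (hU hp)
  constructor
  · intro H p hp
    have hd : Differentiable ℝ ρ := (hρ.of_le h1).differentiable one_ne_zero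
    have hf0 : fderiv ℝ ρ p (f p) = 0 := by
      simpa using aux_tangent f g ρ hd 0 (hF 0) H p hp
    refine ⟨hf0, fun j => ?_⟩
    have := aux_tangent f g ρ hd (Pi.single j 1) (hF _) H p hp
    simpa [Pi.single_apply, hf0] using this
  · rintro H T hT u x ⟨hx, k, τ, hτ0, hτk, hτ, hsol⟩ hx0
    have key : ∀ i : Fin (k + 1), ∀ t ∈ Set.Icc 0 (τ i), ρ (x t) = 0 := by
      intro i
      induction i using Fin.induction with
      | zero =>
        intro t ht
        rw [hτ0] at ht
        rw [le_antisymm ht.2 ht.1]; exact hx0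
      | succ i ih =>
        intro t ht
        rcases le_total t (τ i.castSucc) with h | h
        · exact ih t ⟨ht.1, h⟩
        · have hi0 : 0 ≤ τ i.castSucc := hτ0 ▸ hτ.monotone (Fin.zero_le _)
          have hiT : τ i.succ ≤ T := hτk ▸ hτ.monotone (Fin.le_last _)
          obtain ⟨⟨c, hc⟩, hd⟩ := hsol i
          refine aux_interval ρ (fun p => f p + ∑ j, c j • g j p) (hρ.of_le h2) (hF c) ?_ hs
            (τ i.castSucc) (τ i.succ) x (hx.mono (Set.Icc_subset_Icc hi0 hiT)) ?_
            (ih _ ⟨hi0, le_rfl⟩) t ⟨h, ht.2⟩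
          · intro p hp
            simp [(H p hp).1, (H p hp).2]
          · intro s hs
            have := hd s hs
            rwa [hc s hs] at this
    intro t ht
    exact key (Fin.last k) t (by rwa [hτk])
end

section
/- Let a, b be positive real numbers and consider the driftless control system on ℝ⁴ given by ẋ = a·cos(w)·u₁, ẏ = sin(w)·u₁, ż = b·cos(w)·u₁, ẇ = u₂. For any two points p = (p₁,p₂,p₃,p₄) and q = (q₁,q₂,q₃,q₄) in ℝ⁴ with b·p₁ − a·p₃ = b·q₁ − a·q₃, there exist T ≥ 0, a piecewise constant control u : [0,T] → ℝ², and a solution x : [0,T] → ℝ⁴ of the system with control u such that x(0) = p and x(T) = q. -/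
noncomputable def rampFn (c s : ℝ) : ℝ := max 0 (min 1 (s - c))

lemma ramp_cont (c : ℝ) : Continuous (rampFn c) := by
  unfold rampFn; fun_prop

lemma ramp_eq0 {c s : ℝ} (h : s ≤ c) : rampFn c s = 0 := by
  unfold rampFn
  rw [min_eq_right (by linarith), max_eq_left (by linarith)]

lemma ramp_eq1 {c s : ℝ} (h : c + 1 ≤ s) : rampFn c s = 1 := by
  unfold rampFn
  rw [min_eq_left (by linarith), max_eq_right (by linarith)]

lemma ramp_d0 {c s : ℝ} (h : s < c) : HasDerivAt (rampFn c) 0 s := by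
  refine (hasDerivAt_const s (0 : ℝ)).congr_of_eventuallyEq ?_
  filter_upwards [Iio_mem_nhds h] with t ht
  exact ramp_eq0 (le_of_lt ht)

lemma ramp_d2 {c s : ℝ} (h : c + 1 < s) : HasDerivAt (rampFn c) 0 s := by
  refine (hasDerivAt_const s (1 : ℝ)).congr_of_eventuallyEq ?_
  filter_upwards [Ioi_mem_nhds h] with t ht
  exact ramp_eq1 (le_of_lt ht)

lemma ramp_d1 {c s : ℝ} (h : c < s) (h' : s < c + 1) : HasDerivAt (rampFn c) 1 s := by
  refine ((hasDerivAt_id s).sub_const c).congr_of_eventuallyEq ?_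
  filter_upwards [Ioo_mem_nhds h h'] with t ht
  have h1 := ht.1
  have h2 := ht.2
  unfold rampFn
  rw [min_eq_right (by linarith), max_eq_right (by linarith)]
  rfl

/-- Example 3: for `a, b > 0`, the driftless system
`ẋ = a cos(w) u₁, ẏ = sin(w) u₁, ż = b cos(w) u₁, ẇ = u₂` restricted to an invariant
hyperplane `{b·x − a·z = const}` is controllable: any two points `p, q` of ℝ⁴ with
`b·p₁ − a·p₃ = b·q₁ − a·q₃` are joined by a solution with piecewise constant control. -/
theorem example3_controllable_on_hyperplane
    (a b : ℝ) (ha : 0 < a) (hb : 0 < b) (p₁ p₂ p₃ p₄ q₁ q₂ q₃ q₄ : ℝ)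
    (hpq : b * p₁ - a * p₃ = b * q₁ - a * q₃) :
    ∃ T : ℝ, 0 ≤ T ∧ ∃ u₁ u₂ x y z w : ℝ → ℝ,
      ContinuousOn x (Set.Icc 0 T) ∧ ContinuousOn y (Set.Icc 0 T) ∧
      ContinuousOn z (Set.Icc 0 T) ∧ ContinuousOn w (Set.Icc 0 T) ∧
      (∃ k : ℕ, ∃ τ : Fin (k + 1) → ℝ, τ 0 = 0 ∧ τ (Fin.last k) = T ∧ StrictMono τ ∧
        ∀ i : Fin k,
          (∃ c₁ c₂ : ℝ, ∀ s ∈ Set.Ioo (τ i.castSucc) (τ i.succ), u₁ s = c₁ ∧ u₂ s = c₂) ∧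
          ∀ s ∈ Set.Ioo (τ i.castSucc) (τ i.succ),
            HasDerivAt x (a * Real.cos (w s) * u₁ s) s ∧
            HasDerivAt y (Real.sin (w s) * u₁ s) s ∧
            HasDerivAt z (b * Real.cos (w s) * u₁ s) s ∧
            HasDerivAt w (u₂ s) s) ∧
      x 0 = p₁ ∧ y 0 = p₂ ∧ z 0 = p₃ ∧ w 0 = p₄ ∧
      x T = q₁ ∧ y T = q₂ ∧ z T = q₃ ∧ w T = q₄ := by
  obtain ⟨r, θ, hX, hY⟩ : ∃ r θ : ℝ, r * Real.cos θ = (q₁ - p₁) / a ∧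
      r * Real.sin θ = q₂ - p₂ := by
    refine ⟨‖(⟨(q₁ - p₁) / a, q₂ - p₂⟩ : ℂ)‖, Complex.arg ⟨(q₁ - p₁) / a, q₂ - p₂⟩, ?_, ?_⟩
    · rw [Complex.norm_mul_cos_arg]
    · rw [Complex.norm_mul_sin_arg]
  have hX' : a * (r * Real.cos θ) = q₁ - p₁ := by rw [hX]; field_simp
  have hZ' : b * (r * Real.cos θ) = q₃ - p₃ := by
    apply mul_left_cancel₀ ha.ne'
    linear_combination b * hX' - hpq
  have c0 := ramp_cont 0
  have c1 := ramp_cont 1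
  have c2 := ramp_cont 2
  refine ⟨3, by norm_num, fun s => if s < 1 then 0 else if s < 2 then r else 0,
    fun s => if s < 1 then θ - p₄ else if s < 2 then 0 else q₄ - θ,
    fun s => p₁ + a * (r * Real.cos θ) * rampFn 1 s,
    fun s => p₂ + (r * Real.sin θ) * rampFn 1 s,
    fun s => p₃ + b * (r * Real.cos θ) * rampFn 1 s,
    fun s => p₄ + (θ - p₄) * rampFn 0 s + (q₄ - θ) * rampFn 2 s,
    by fun_prop, by fun_prop, by fun_prop, by fun_prop, ?_, ?_⟩
  · refine ⟨3, fun i => ((i : ℕ) : ℝ), by simp, by simp, ?_, ?_⟩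
    · intro i j hij
      have h : (i : ℕ) < (j : ℕ) := hij
      show ((i : ℕ) : ℝ) < ((j : ℕ) : ℝ)
      exact_mod_cast h
    · have key : ∀ s d0 d1 d2 u v : ℝ, HasDerivAt (rampFn 0) d0 s → HasDerivAt (rampFn 1) d1 s →
          HasDerivAt (rampFn 2) d2 s → ∀ W : ℝ,
          r * Real.cos θ * d1 = Real.cos W * u → r * Real.sin θ * d1 = Real.sin W * u →
          (θ - p₄) * d0 + (q₄ - θ) * d2 = v →
          HasDerivAt (fun s => p₁ + a * (r * Real.cos θ) * rampFn 1 s) (a * Real.cos W * u) s ∧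
          HasDerivAt (fun s => p₂ + (r * Real.sin θ) * rampFn 1 s) (Real.sin W * u) s ∧
          HasDerivAt (fun s => p₃ + b * (r * Real.cos θ) * rampFn 1 s) (b * Real.cos W * u) s ∧
          HasDerivAt (fun s => p₄ + (θ - p₄) * rampFn 0 s + (q₄ - θ) * rampFn 2 s) v s := by
        intro s d0 d1 d2 u v h0 h1 h2 W e1 e2 e3
        refine ⟨?_, ?_, ?_, ?_⟩
        · refine HasDerivAt.congr_deriv ((h1.const_mul (a * (r * Real.cos θ))).const_add p₁) ?_
          linear_combination a * e1
        · refine HasDerivAt.congr_deriv ((h1.const_mul (r * Real.sin θ)).const_add p₂) ?_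
          linear_combination e2
        · refine HasDerivAt.congr_deriv ((h1.const_mul (b * (r * Real.cos θ))).const_add p₃) ?_
          linear_combination b * e1
        · refine HasDerivAt.congr_deriv (((h0.const_mul (θ - p₄)).const_add p₄).add (h2.const_mul (q₄ - θ))) ?_
          exact e3
      have main : ∀ n : ℕ, n < 3 →
          (∃ c₁ c₂ : ℝ, ∀ s ∈ Set.Ioo (n : ℝ) ((n : ℝ) + 1),
            (if s < 1 then 0 else if s < 2 then r else 0) = c₁ ∧
            (if s < 1 then θ - p₄ else if s < 2 then 0 else q₄ - θ) = c₂) ∧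
          ∀ s ∈ Set.Ioo (n : ℝ) ((n : ℝ) + 1), ∃ d0 d1 d2 : ℝ,
            HasDerivAt (rampFn 0) d0 s ∧ HasDerivAt (rampFn 1) d1 s ∧
            HasDerivAt (rampFn 2) d2 s ∧
            r * Real.cos θ * d1 =
              Real.cos (p₄ + (θ - p₄) * rampFn 0 s + (q₄ - θ) * rampFn 2 s) *
                (if s < 1 then 0 else if s < 2 then r else 0) ∧
            r * Real.sin θ * d1 =
              Real.sin (p₄ + (θ - p₄) * rampFn 0 s + (q₄ - θ) * rampFn 2 s) *
                (if s < 1 then 0 else if s < 2 then r else 0) ∧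
            (θ - p₄) * d0 + (q₄ - θ) * d2 =
              (if s < 1 then θ - p₄ else if s < 2 then 0 else q₄ - θ) := by
        intro n hn
        interval_cases n
        · have hs1 : ∀ s ∈ Set.Ioo ((0 : ℕ) : ℝ) (((0 : ℕ) : ℝ) + 1), 0 < s ∧ s < 1 := by
            rintro s ⟨h1, h2⟩
            norm_num at h1 h2
            exact ⟨h1, h2⟩
          refine ⟨⟨0, θ - p₄, fun s hs => ?_⟩, fun s hs => ?_⟩
          · obtain ⟨h1, h2⟩ := hs1 s hs
            simp [h2]
          · obtain ⟨h1, h2⟩ := hs1 s hs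
            refine ⟨1, 0, 0, ramp_d1 h1 (by linarith), ramp_d0 h2, ramp_d0 (by linarith), ?_⟩
            simp [h2]
        · have hs1 : ∀ s ∈ Set.Ioo ((1 : ℕ) : ℝ) (((1 : ℕ) : ℝ) + 1), ¬ s < 1 ∧ s < 2 := by
            rintro s ⟨h1, h2⟩
            norm_num at h1 h2
            exact ⟨by linarith, by linarith⟩
          refine ⟨⟨r, 0, fun s hs => ?_⟩, fun s hs => ?_⟩
          · obtain ⟨h1, h2⟩ := hs1 s hs
            simp [h1, h2]
          · obtain ⟨h1, h2⟩ := hs1 s hs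
            have h3 : 1 < s := by simpa using hs.1
            refine ⟨0, 1, 0, ramp_d2 (by linarith), ramp_d1 h3 (by linarith),
              ramp_d0 (by linarith), ?_⟩
            rw [ramp_eq1 (c := 0) (by linarith), ramp_eq0 (c := 2) (by linarith)]
            simp [h1, h2, mul_comm]
        · have hs1 : ∀ s ∈ Set.Ioo ((2 : ℕ) : ℝ) (((2 : ℕ) : ℝ) + 1), 2 < s ∧ s < 3 := by
            rintro s ⟨h1, h2⟩
            norm_num at h1 h2
            exact ⟨by linarith, by linarith⟩
          refine ⟨⟨0, q₄ - θ, fun s hs => ?_⟩, fun s hs => ?_⟩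
          · obtain ⟨h1, h2⟩ := hs1 s hs
            have h3 : ¬ s < 1 := by linarith
            have h4 : ¬ s < 2 := by linarith
            simp [h3, h4]
          · obtain ⟨h1, h2⟩ := hs1 s hs
            have h3 : ¬ s < 1 := by linarith
            have h4 : ¬ s < 2 := by linarith
            refine ⟨0, 0, 1, ramp_d2 (by linarith), ramp_d2 (by linarith),
              ramp_d1 h1 (by linarith), ?_⟩
            simp [h3, h4]
      intro i
      obtain ⟨m1, m2⟩ := main i i.2
      simp only [Fin.val_castSucc, Fin.val_succ, Nat.cast_add, Nat.cast_one]
      refine ⟨m1, fun s hs => ?_⟩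
      obtain ⟨d0, d1, d2, h0, h1, h2, e1, e2, e3⟩ := m2 s hs
      exact key s d0 d1 d2 _ _ h0 h1 h2 _ e1 e2 e3
  · have z0 : rampFn 0 0 = 0 := ramp_eq0 le_rfl
    have z1 : rampFn 1 0 = 0 := ramp_eq0 (by norm_num)
    have z2 : rampFn 2 0 = 0 := ramp_eq0 (by norm_num)
    have o0 : rampFn 0 3 = 1 := ramp_eq1 (by norm_num)
    have o1 : rampFn 1 3 = 1 := ramp_eq1 (by norm_num)
    have o2 : rampFn 2 3 = 1 := ramp_eq1 (by norm_num)
    simp only [z0, z1, z2, o0, o1, o2]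
    refine ⟨by ring, by ring, by ring, by ring, ?_, ?_, ?_, by ring⟩ <;> linarith
end

section
/- Let a, b be positive real numbers, let α : ℝ⁴ → ℝ be a smooth function, and set φ(x,y,z,w) = (b·x − a·z)·α(x,y,z,w). Consider the affine control system on ℝ⁴ with drift f = (φ, 1, 0, 0): ẋ = φ(x,y,z,w) + a·cos(w)·u₁, ẏ = 1 + sin(w)·u₁, ż = b·cos(w)·u₁, ẇ = u₂. Then for every T > 0, every piecewise constant control (u₁,u₂) : [0,T] → ℝ², and every solution (x,y,z,w) : [0,T] → ℝ⁴ with b·x(0) − a·z(0) = 0, one has b·x(t) − a·z(t) = 0 for all t ∈ [0,T]. -/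
theorem aux_gron (f g : ℝ → ℝ) (p q K : ℝ) (hf : ContinuousOn f (Set.Icc p q))
    (hd : ∀ s ∈ Set.Ioo p q, HasDerivAt f (f s * g s) s)
    (hK : ∀ s ∈ Set.Ioo p q, g s ≤ K) (h0 : f p = 0) :
    ∀ t ∈ Set.Icc p q, f t = 0 := by
  have hder : ∀ s ∈ Set.Ioo p q, HasDerivAt (fun t => f t ^ 2 * Real.exp (-(2 * K) * t))
      (2 * f s ^ 2 * (g s - K) * Real.exp (-(2 * K) * s)) s := by
    intro s hs
    have h1 := (hd s hs).pow 2
    have h2 : HasDerivAt (fun t => Real.exp (-(2 * K) * t))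
        (Real.exp (-(2 * K) * s) * (-(2 * K))) s := by
      simpa using ((hasDerivAt_id s).const_mul (-(2 * K))).exp
    have h3 := h1.mul h2
    refine h3.congr_deriv ?_
    simp
    ring
  have hanti : AntitoneOn (fun t => f t ^ 2 * Real.exp (-(2 * K) * t)) (Set.Icc p q) := by
    apply antitoneOn_of_deriv_nonpos (convex_Icc p q)
    · exact (hf.pow 2).mul (by fun_prop)
    · rw [interior_Icc]
      exact fun s hs => (hder s hs).differentiableAt.differentiableWithinAt
    · rw [interior_Icc]
      intro s hs
      rw [(hder s hs).deriv]
      have := hK s hs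
      apply mul_nonpos_of_nonpos_of_nonneg _ (Real.exp_pos _).le
      exact mul_nonpos_of_nonneg_of_nonpos (by positivity) (by linarith)
  intro t ht
  have h := hanti ⟨le_rfl, ht.1.trans ht.2⟩ ht ht.1
  simp only [h0] at h
  have hp := Real.exp_pos (-(2 * K) * t)
  have : f t ^ 2 ≤ 0 := by
    by_contra hc
    push Not at hc
    have := mul_pos hc hp
    linarith
  exact pow_eq_zero_iff (two_ne_zero) |>.1 (le_antisymm this (sq_nonneg _))

/-- Example 4: for the slanted-plane system with drift `f = (φ, 1, 0, 0)` where
`φ = (b·x − a·z)·α` is divisible by `ρ = b·x − a·z`, the single hyperplane `{b·x − a·z = 0}`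
is invariant under piecewise constant controls. -/
theorem example4_invariant_hyperplane
    (a b : ℝ) (ha : 0 < a) (hb : 0 < b)
    (α : ℝ × ℝ × ℝ × ℝ → ℝ) (hα : ContDiff ℝ (⊤ : ℕ∞) α)
    (T : ℝ) (hT : 0 < T) (u₁ u₂ x y z w : ℝ → ℝ)
    (hx : ContinuousOn x (Set.Icc 0 T)) (hy : ContinuousOn y (Set.Icc 0 T))
    (hz : ContinuousOn z (Set.Icc 0 T)) (hw : ContinuousOn w (Set.Icc 0 T))
    (hsol : ∃ k : ℕ, ∃ τ : Fin (k + 1) → ℝ, τ 0 = 0 ∧ τ (Fin.last k) = T ∧ StrictMono τ ∧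
      ∀ i : Fin k,
        (∃ c₁ c₂ : ℝ, ∀ s ∈ Set.Ioo (τ i.castSucc) (τ i.succ), u₁ s = c₁ ∧ u₂ s = c₂) ∧
        ∀ s ∈ Set.Ioo (τ i.castSucc) (τ i.succ),
          HasDerivAt x ((b * x s - a * z s) * α (x s, y s, z s, w s) +
            a * Real.cos (w s) * u₁ s) s ∧
          HasDerivAt y (1 + Real.sin (w s) * u₁ s) s ∧
          HasDerivAt z (b * Real.cos (w s) * u₁ s) s ∧
          HasDerivAt w (u₂ s) s)
    (h0 : b * x 0 - a * z 0 = 0) :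
    ∀ t ∈ Set.Icc (0:ℝ) T, b * x t - a * z t = 0 := by
  obtain ⟨k, τ, hτ0, hτT, hmono, hs⟩ := hsol
  have hα' : ContinuousOn (fun s => b * α (x s, y s, z s, w s)) (Set.Icc 0 T) :=
    continuousOn_const.mul
      (hα.continuous.comp_continuousOn (hx.prodMk (hy.prodMk (hz.prodMk hw))))
  obtain ⟨K, hK⟩ := isCompact_Icc.bddAbove_image hα'
  have hρ : ContinuousOn (fun s => b * x s - a * z s) (Set.Icc 0 T) :=
    (continuousOn_const.mul hx).sub (continuousOn_const.mul hz)
  have key : ∀ i : Fin (k + 1), ∀ t ∈ Set.Icc 0 (τ i), b * x t - a * z t = 0 := by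
    intro i
    induction i using Fin.induction with
    | zero =>
      intro t ht
      rw [hτ0] at ht
      rw [le_antisymm ht.2 ht.1]
      exact h0
    | succ i ih =>
      intro t ht
      have hp : 0 ≤ τ i.castSucc := hτ0 ▸ hmono.monotone (Fin.zero_le _)
      have hq : τ i.succ ≤ T := hτT ▸ hmono.monotone (Fin.le_last _)
      rcases le_total t (τ i.castSucc) with h | h
      · exact ih t ⟨ht.1, h⟩
      · refine aux_gron (fun s => b * x s - a * z s) (fun s => b * α (x s, y s, z s, w s))
          (τ i.castSucc) (τ i.succ) K (hρ.mono (Set.Icc_subset_Icc hp hq)) ?_ ?_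
          (ih _ ⟨hp, le_rfl⟩) t ⟨h, ht.2⟩
        · intro s hs'
          obtain ⟨h1, -, h3, -⟩ := (hs i).2 s hs'
          refine ((h1.const_mul b).sub (h3.const_mul a)).congr_deriv ?_
          ring
        · intro s hs'
          exact hK ⟨s, ⟨hp.trans hs'.1.le, hs'.2.le.trans hq⟩, rfl⟩
  intro t ht
  exact key (Fin.last k) t (by rw [hτT]; exact ht)
end

section
/- Let a, b be positive real numbers, define g₁(x,y,z,w) = (a·cos w, sin w, b·cos w, 0) and g₂(x,y,z,w) = (0,0,0,1) on ℝ⁴, and let f : ℝ⁴ → ℝ⁴ be a smooth vector field such that for every p ∈ ℝ⁴ the vector f(p) lies in the linear span of g₁(p) and g₂(p). Then for every T > 0, every piecewise constant control (u₁,u₂) : [0,T] → ℝ², and every solution x : [0,T] → ℝ⁴ of ẋ = f(x) + u₁·g₁(x) + u₂·g₂(x), one has b·x₁(t) − a·x₃(t) = b·x₁(0) − a·x₃(0) for all t ∈ [0,T]. -/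
/-- Example 4, case (a): if the drift `f` lies pointwise in the linear span of
`g₁ = (a cos w, sin w, b cos w, 0)` and `g₂ = (0,0,0,1)`, then `ρ = b·x − a·z` is a first
integral: it is constant along every solution of `ẋ = f(x) + u₁ g₁(x) + u₂ g₂(x)` with
piecewise constant control, so ℝ⁴ is foliated by the invariant hyperplanes `{ρ = const}`. -/
theorem example4_span_firstIntegral
    (a b : ℝ) (ha : 0 < a) (hb : 0 < b)
    (g₁ g₂ f : (Fin 4 → ℝ) → (Fin 4 → ℝ))
    (hg₁ : g₁ = fun p => ![a * Real.cos (p 3), Real.sin (p 3), b * Real.cos (p 3), 0])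
    (hg₂ : g₂ = fun _ => ![0, 0, 0, 1])
    (hf : ContDiff ℝ (⊤ : ℕ∞) f)
    (hspan : ∀ p : Fin 4 → ℝ, ∃ c₁ c₂ : ℝ, f p = c₁ • g₁ p + c₂ • g₂ p)
    (T : ℝ) (hT : 0 < T) (u₁ u₂ : ℝ → ℝ) (x : ℝ → (Fin 4 → ℝ))
    (hcont : ContinuousOn x (Set.Icc 0 T))
    (hsol : ∃ k : ℕ, ∃ τ : Fin (k + 1) → ℝ, τ 0 = 0 ∧ τ (Fin.last k) = T ∧ StrictMono τ ∧
      ∀ i : Fin k,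
        (∃ c₁ c₂ : ℝ, ∀ s ∈ Set.Ioo (τ i.castSucc) (τ i.succ), u₁ s = c₁ ∧ u₂ s = c₂) ∧
        ∀ s ∈ Set.Ioo (τ i.castSucc) (τ i.succ),
          HasDerivAt x (f (x s) + u₁ s • g₁ (x s) + u₂ s • g₂ (x s)) s) :
    ∀ t ∈ Set.Icc (0:ℝ) T, b * x t 0 - a * x t 2 = b * x 0 0 - a * x 0 2 := by
  obtain ⟨k, τ, h0, hl, hmono, hstep⟩ := hsol
  have hρc : ContinuousOn (fun t => b * x t 0 - a * x t 2) (Set.Icc 0 T) := by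
    have h := continuousOn_pi.1 hcont
    exact (continuousOn_const.mul (h 0)).sub (continuousOn_const.mul (h 2))
  have hρd : ∀ i : Fin k, ∀ s ∈ Set.Ioo (τ i.castSucc) (τ i.succ),
      HasDerivAt (fun t => b * x t 0 - a * x t 2) 0 s := by
    intro i s hs
    have h := hasDerivAt_pi.1 ((hstep i).2 s hs)
    have h2 := ((h 0).const_mul b).sub ((h 2).const_mul a)
    obtain ⟨c₁, c₂, hc⟩ := hspan (x s)
    refine h2.congr_deriv ?_
    rw [hc, hg₁, hg₂]
    simp
    ring
  have key : ∀ i : Fin (k + 1), ∀ t ∈ Set.Icc (0:ℝ) (τ i),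
      b * x t 0 - a * x t 2 = b * x 0 0 - a * x 0 2 := by
    intro i
    induction i using Fin.induction with
    | zero =>
      intro t ht
      rw [h0] at ht
      have : t = 0 := le_antisymm ht.2 ht.1
      rw [this]
    | succ i ih =>
      intro t ht
      rcases le_or_gt t (τ i.castSucc) with hle | hlt
      · exact ih t ⟨ht.1, hle⟩
      · have hnn : 0 ≤ τ i.castSucc := by
          rw [← h0]; exact hmono.monotone (Fin.zero_le _)
        have hT' : τ i.succ ≤ T := by
          rw [← hl]; exact hmono.monotone (Fin.le_last _)
        rw [← ih (τ i.castSucc) ⟨hnn, le_rfl⟩]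
        obtain ⟨c, -, hc⟩ := exists_hasDerivAt_eq_slope
          (fun t => b * x t 0 - a * x t 2) (fun _ => 0) hlt
          (hρc.mono (Set.Icc_subset_Icc hnn (ht.2.trans hT')))
          (fun s hs => hρd i s ⟨hs.1, hs.2.trans_le ht.2⟩)
        have hne : t - τ i.castSucc ≠ 0 := (sub_pos.2 hlt).ne'
        rw [eq_div_iff hne, zero_mul] at hc
        linarith
  intro t ht
  exact key (Fin.last k) t (by rw [hl]; exact ht)
end

section
/- Let θ¹, …, θ^s : ℝⁿ → (ℝⁿ)* be smooth 1-forms (smooth maps into continuous linear functionals on ℝⁿ) that are linearly independent at every point of ℝⁿ, and let ρ = (ρ¹, …, ρ^d) : ℝⁿ → ℝ^d, with d ≤ s, be a smooth map whose derivative Dρ(x) : ℝⁿ → ℝ^d is surjective at every point of a neighborhood of N = ρ⁻¹(0). Suppose that for every x ∈ N and every v ∈ ℝⁿ with θ¹(x)(v) = ⋯ = θ^s(x)(v) = 0 one has Dρ^μ(x)(v) = 0 for each μ = 1, …, d. Then every point of N has an open neighborhood U on which there exist smooth 1-forms ψ^μ_λ : U → (ℝⁿ)* and smooth functions b^μ_γ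 : U → ℝ (1 ≤ μ, λ ≤ d, 1 ≤ γ ≤ s) such that dρ^μ = Σ_{λ=1}^d ρ^λ·ψ^μ_λ + Σ_{γ=1}^s b^μ_γ·θ^γ on U, where dρ^μ(x) = Dρ^μ(x). -/
open Filter Topology in
theorem aux_hasFDerivAt_param {H F : Type} [NormedAddCommGroup H] [NormedSpace ℝ H]
    [FiniteDimensional ℝ H] [NormedAddCommGroup F] [NormedSpace ℝ F]
    (f : H × ℝ → F) (hf : ContDiff ℝ (⊤ : ℕ∞) f) (x₀ : H) :
    HasFDerivAt (fun x => ∫ t in (0:ℝ)..1, f (x, t))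
      (∫ t in (0:ℝ)..1, (fderiv ℝ f (x₀, t)).comp (ContinuousLinearMap.inl ℝ H ℝ)) x₀ := by
  have hd : Continuous (fun q : H × ℝ =>
      (fderiv ℝ f q).comp (ContinuousLinearMap.inl ℝ H ℝ)) :=
    (hf.continuous_fderiv (by simp)).clm_comp continuous_const
  have hfc := hf.continuous
  obtain ⟨C, hC⟩ := ((isCompact_closedBall x₀ 1).prod (isCompact_Icc (a := (0:ℝ)) (b := 1))).exists_bound_of_continuousOn hd.continuousOn
  refine intervalIntegral.hasFDerivAt_integral_of_dominated_of_fderiv_le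
    (F := fun x t => f (x, t))
    (F' := fun x t => (fderiv ℝ f (x, t)).comp (ContinuousLinearMap.inl ℝ H ℝ))
    (s := Metric.closedBall x₀ 1) (bound := fun _ => C)
    (Metric.closedBall_mem_nhds _ one_pos) ?_ ?_ ?_ ?_ ?_ ?_
  · refine Eventually.of_forall fun x => Continuous.aestronglyMeasurable ?_
    fun_prop
  · refine Continuous.intervalIntegrable ?_ _ _
    fun_prop
  · have : SecondCountableTopologyEither ℝ (H →L[ℝ] F) := ⟨Or.inl inferInstance⟩
    refine Continuous.aestronglyMeasurable ?_
    exact hd.comp (by fun_prop : Continuous fun t : ℝ => (x₀, t))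
  · refine Eventually.of_forall fun t ht x hx => hC (x, t) ⟨hx, ?_⟩
    rw [Set.uIoc_of_le zero_le_one] at ht
    exact ⟨ht.1.le, ht.2⟩
  · exact intervalIntegrable_const
  · refine Eventually.of_forall fun t ht x hx => ?_
    have h1 : HasFDerivAt f (fderiv ℝ f (x, t)) (x, t) :=
      (hf.differentiable (by simp) _).hasFDerivAt
    exact h1.comp x (hasFDerivAt_prodMk_left x t)

theorem aux_contDiff_param_nat {H : Type} [NormedAddCommGroup H] [NormedSpace ℝ H]
    [FiniteDimensional ℝ H] (k : ℕ) : ∀ {F : Type} [NormedAddCommGroup F] [NormedSpace ℝ F]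
    (f : H × ℝ → F) (_ : ContDiff ℝ (⊤ : ℕ∞) f),
    ContDiff ℝ k (fun x => ∫ t in (0:ℝ)..1, f (x, t)) := by
  induction k with
  | zero =>
    intro F _ _ f hf
    simp only [Nat.cast_zero, contDiff_zero]
    exact intervalIntegral.continuous_parametric_intervalIntegral_of_continuous'
      (f := fun x t => f (x, t)) hf.continuous 0 1
  | succ k ih =>
    intro F _ _ f hf
    push_cast
    rw [contDiff_succ_iff_hasFDerivAt]
    refine ⟨_, ?_, aux_hasFDerivAt_param f hf⟩
    refine ih (fun q : H × ℝ => (fderiv ℝ f q).comp (ContinuousLinearMap.inl ℝ H ℝ)) ?_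
    exact (hf.fderiv_right (m := (⊤ : ℕ∞)) (by simp)).clm_comp contDiff_const

theorem aux_contDiff_param {H : Type} [NormedAddCommGroup H] [NormedSpace ℝ H]
    [FiniteDimensional ℝ H] {F : Type} [NormedAddCommGroup F] [NormedSpace ℝ F]
    (f : H × ℝ → F) (hf : ContDiff ℝ (⊤ : ℕ∞) f) :
    ContDiff ℝ (⊤ : ℕ∞) (fun x => ∫ t in (0:ℝ)..1, f (x, t)) :=
  contDiff_infty.2 fun k => aux_contDiff_param_nat k f hf

/-- Hadamard lemma, linear version. -/
theorem aux_hadamard_linear {d : ℕ} {E F : Type} [NormedAddCommGroup E] [NormedSpace ℝ E]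
    [FiniteDimensional ℝ E] [NormedAddCommGroup F] [NormedSpace ℝ F] [CompleteSpace F]
    (A : E →L[ℝ] (Fin d → ℝ)) (R : (Fin d → ℝ) →L[ℝ] E) (hAR : ∀ y, A (R y) = y)
    (Q : E → F) (hQ : ContDiff ℝ (⊤ : ℕ∞) Q) (hQ0 : ∀ w, A w = 0 → Q w = 0) :
    ∃ G : Fin d → E → F, (∀ i, ContDiff ℝ (⊤ : ℕ∞) (G i)) ∧
      ∀ w, Q w = ∑ i, A w i • G i w := by
  have hsm : ∀ y : Fin d → ℝ, ContDiff ℝ (⊤ : ℕ∞)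
      (fun q : E × ℝ => fderiv ℝ Q (q.1 - (1 - q.2) • R (A q.1)) (R y)) := by
    intro y
    have h1 : ContDiff ℝ (⊤ : ℕ∞) (fderiv ℝ Q) := hQ.fderiv_right (by simp)
    have h2 : ContDiff ℝ (⊤ : ℕ∞) (fun q : E × ℝ => q.1 - (1 - q.2) • R (A q.1)) := by
      fun_prop
    exact (h1.comp h2).clm_apply contDiff_const
  refine ⟨fun i w => ∫ t in (0:ℝ)..1, fderiv ℝ Q (w - (1 - t) • R (A w)) (R (Pi.single i 1)),
    fun i => aux_contDiff_param _ (hsm _), fun w => ?_⟩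
  have hc : ∀ y : Fin d → ℝ, Continuous fun t : ℝ =>
      fderiv ℝ Q (w - (1 - t) • R (A w)) (R y) := fun y =>
    (hsm y).continuous.comp (by fun_prop : Continuous fun t : ℝ => (w, t))
  have hftc : ∫ t in (0:ℝ)..1, fderiv ℝ Q (w - (1 - t) • R (A w)) (R (A w))
      = Q (w - (1 - (1:ℝ)) • R (A w)) - Q (w - (1 - (0:ℝ)) • R (A w)) := by
    refine intervalIntegral.integral_eq_sub_of_hasDerivAt
      (f := fun t : ℝ => Q (w - (1 - t) • R (A w))) (fun t _ => ?_)
      ((hc _).intervalIntegrable _ _)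
    have h1 : HasFDerivAt Q (fderiv ℝ Q (w - (1 - t) • R (A w))) (w - (1 - t) • R (A w)) :=
      (hQ.differentiable (by simp) _).hasFDerivAt
    have h2 : HasDerivAt (fun t : ℝ => w - (1 - t) • R (A w)) (R (A w)) t := by
      have := (((hasDerivAt_id t).const_sub 1).smul_const (R (A w))).const_sub w
      simpa using this
    exact h1.comp_hasDerivAt t h2
  have h0 : Q (w - (1 - (0:ℝ)) • R (A w)) = 0 := hQ0 _ (by simp [hAR])
  rw [h0] at hftc
  simp only [sub_self, zero_smul, sub_zero] at hftc
  rw [← hftc]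
  have hdec : ∀ t : ℝ, fderiv ℝ Q (w - (1 - t) • R (A w)) (R (A w)) =
      ∑ i, A w i • fderiv ℝ Q (w - (1 - t) • R (A w)) (R (Pi.single i 1)) := by
    intro t
    generalize fderiv ℝ Q (w - (1 - t) • R (A w)) = L
    conv_lhs => rw [pi_eq_sum_univ' (A w)]
    simp only [map_sum, map_smul]
  simp_rw [hdec]
  rw [intervalIntegral.integral_finsetSum]
  · simp_rw [intervalIntegral.integral_smul]
  · intro i _
    exact ((hc _).const_smul _).intervalIntegrable _ _

open Filter Topology in
theorem aux_hadamard {d : ℕ} {E F : Type} [NormedAddCommGroup E] [NormedSpace ℝ E]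
    [FiniteDimensional ℝ E] [NormedAddCommGroup F] [NormedSpace ℝ F] [CompleteSpace F]
    (ρ : E → (Fin d → ℝ)) (hρ : ContDiff ℝ (⊤ : ℕ∞) ρ) (p : E)
    (hs : Function.Surjective (fderiv ℝ ρ p))
    (P : E → F) (hP : ∀ᶠ x in 𝓝 p, ContDiffAt ℝ (⊤ : ℕ∞) P x)
    (hP0 : ∀ᶠ x in 𝓝 p, ρ x = 0 → P x = 0) :
    ∃ G : Fin d → E → F, (∀ i, ContDiff ℝ (⊤ : ℕ∞) (G i)) ∧
      ∀ᶠ x in 𝓝 p, P x = ∑ i, ρ x i • G i x := by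
  have : CompleteSpace E := FiniteDimensional.complete ℝ E
  set A := fderiv ℝ ρ p with hA
  obtain ⟨R, hR⟩ := A.exists_rightInverse_of_surjective (LinearMap.range_eq_top.2 hs)
  have hAR : ∀ y, A (R y) = y := fun y => DFunLike.congr_fun hR y
  set Φ : E → E := fun x => x - R (A x) + R (ρ x) with hΦdef
  have hΦ : ContDiff ℝ (⊤ : ℕ∞) Φ := by fun_prop
  have hAΦ : ∀ x, A (Φ x) = ρ x := fun x => by simp [hΦdef, hAR]
  have hΦ' : HasFDerivAt Φ ((ContinuousLinearEquiv.refl ℝ E : E ≃L[ℝ] E) : E →L[ℝ] E) p := by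
    have h1 : HasFDerivAt ρ A p := (hρ.differentiable (by simp) p).hasFDerivAt
    have h2 := ((hasFDerivAt_id p).sub ((R.comp A).hasFDerivAt)).add
      (R.hasFDerivAt.comp p h1)
    refine h2.congr_fderiv ?_
    ext v
    simp
  have hst := hΦ.contDiffAt.hasStrictFDerivAt' hΦ' (by simp)
  have hn : ((⊤ : ℕ∞) : WithTop ℕ∞) ≠ 0 := by simp
  set g : E → E := hΦ.contDiffAt.localInverse hΦ' hn with hg
  have hgs : ContDiffAt ℝ (⊤ : ℕ∞) g (Φ p) := hΦ.contDiffAt.to_localInverse hΦ' hn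
  have hgp : g (Φ p) = p := hΦ.contDiffAt.localInverse_apply_image hΦ' hn
  have hgl : ∀ᶠ x in 𝓝 p, g (Φ x) = x := hst.eventually_left_inverse
  have hgr : ∀ᶠ w in 𝓝 (Φ p), Φ (g w) = w := hst.eventually_right_inverse
  have hgt : Tendsto g (𝓝 (Φ p)) (𝓝 p) := by
    have := hgs.continuousAt.tendsto
    rwa [hgp] at this
  have hgs' : ∀ᶠ w in 𝓝 (Φ p), ContDiffAt ℝ (⊤ : ℕ∞) g w := by
    have htar : ∀ᶠ w in 𝓝 (Φ p), w ∈ (hst.toOpenPartialHomeomorph Φ).target :=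
      (hst.toOpenPartialHomeomorph Φ).open_target.mem_nhds
        hst.image_mem_toOpenPartialHomeomorph_target
    have hinv : ∀ᶠ x in 𝓝 p, (fderiv ℝ Φ x).IsInvertible := by
      have := ContinuousLinearEquiv.nhds (ContinuousLinearEquiv.refl ℝ E)
      rw [← hΦ'.fderiv] at this
      exact (hΦ.continuous_fderiv hn).continuousAt.eventually this
    filter_upwards [htar, hgt.eventually hinv] with w hw hi
    obtain ⟨e, he⟩ := hi
    refine (hst.toOpenPartialHomeomorph Φ).contDiffAt_symm (f₀' := e) hw ?_ hΦ.contDiffAt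
    rw [he]
    exact (hΦ.differentiable hn _).hasFDerivAt
  have hV : ∀ᶠ w in 𝓝 (Φ p), ContDiffAt ℝ (⊤ : ℕ∞) (fun w => P (g w)) w ∧
      (A w = 0 → P (g w) = 0) := by
    filter_upwards [hgs', hgr, hgt.eventually hP, hgt.eventually hP0] with w h1 h2 h3 h4
    refine ⟨h3.comp w h1, fun hw => h4 ?_⟩
    rw [← hAΦ, h2, hw]
  obtain ⟨ε, hε, hball⟩ := Metric.eventually_nhds_iff_ball.1 hV
  let χ : ContDiffBump (Φ p) := ⟨ε / 4, ε / 2, by positivity, by linarith⟩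
  have hQ : ContDiff ℝ (⊤ : ℕ∞) (fun w => χ w • P (g w)) := by
    rw [contDiff_iff_contDiffAt]
    intro w
    by_cases hw : w ∈ Metric.ball (Φ p) ε
    · exact χ.contDiff.contDiffAt.smul (hball w hw).1
    · have : w ∉ tsupport χ := by
        rw [χ.tsupport_eq]
        intro h
        apply hw
        rw [Metric.mem_closedBall] at h
        rw [Metric.mem_ball]
        have : χ.rOut = ε / 2 := rfl
        linarith
      have h0 := notMem_tsupport_iff_eventuallyEq.1 this
      refine (contDiffAt_const (c := (0:F))).congr_of_eventuallyEq ?_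
      filter_upwards [h0] with z hz
      simp [hz]
  obtain ⟨G, hG, hGe⟩ := aux_hadamard_linear A R hAR _ hQ (by
    intro w hw
    by_cases hwb : w ∈ Metric.ball (Φ p) ε
    · simp [(hball w hwb).2 hw]
    · have : χ w = 0 := by
        apply χ.zero_of_le_dist
        rw [Metric.mem_ball] at hwb
        have : χ.rOut = ε / 2 := rfl
        linarith
      simp [this])
  refine ⟨fun i x => G i (Φ x), fun i => (hG i).comp hΦ, ?_⟩
  have h1 : ∀ᶠ x in 𝓝 p, χ (Φ x) = 1 :=
    (hΦ.continuous.tendsto p).eventually χ.eventuallyEq_one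
  filter_upwards [hgl, h1] with x hx hx1
  have := hGe (Φ x)
  rw [hx1, hx, one_smul] at this
  simpa [hAΦ] using this

theorem aux_surj {n s : ℕ} (θ : Fin s → ((Fin n → ℝ) →L[ℝ] ℝ)) (h : LinearIndependent ℝ θ) :
    Function.Surjective (ContinuousLinearMap.pi θ) := by
  have : LinearMap.range (ContinuousLinearMap.pi θ : (Fin n → ℝ) →ₗ[ℝ] (Fin s → ℝ)) = ⊤ := by
    by_contra hne
    obtain ⟨f, hf, hle⟩ := Submodule.exists_le_ker_of_lt_top _ (lt_top_iff_ne_top.2 hne)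
    apply hf
    have hz := Fintype.linearIndependent_iff.1 h (fun i => f (Pi.single i 1)) (by
      ext1 v
      have h1 : f (ContinuousLinearMap.pi θ v) = 0 := hle ⟨v, rfl⟩
      rw [pi_eq_sum_univ' (ContinuousLinearMap.pi θ v)] at h1
      simpa [map_sum, mul_comm] using h1)
    ext i
    simpa using hz i
  exact LinearMap.range_eq_top.1 this

/-- Proposition 3.3 (local, nontrivial direction): if a non-degenerate map
`ρ = (ρ¹, …, ρ^d)` is a system of generalized first integrals of the distribution
`D = ∩_γ ker θ^γ` annihilated by pointwise linearly independent 1-forms `θ¹, …, θ^s`,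
then locally near each point of `N = ρ⁻¹(0)` each `dρ^μ` lies in the algebraic ideal
generated by `ρ` and `θ¹, …, θ^s`:
`dρ^μ = ∑_λ ρ^λ ψ^μ_λ + ∑_γ b^μ_γ θ^γ` for smooth `ψ^μ_λ`, `b^μ_γ`. -/
theorem generalizedFirstIntegral_ideal_membership
    (n s d : ℕ) (hds : d ≤ s)
    (θ : Fin s → (Fin n → ℝ) → ((Fin n → ℝ) →L[ℝ] ℝ))
    (hθ : ∀ γ, ContDiff ℝ (⊤ : ℕ∞) (θ γ))
    (hθind : ∀ x : Fin n → ℝ, LinearIndependent ℝ (fun γ => θ γ x))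
    (ρ : (Fin n → ℝ) → (Fin d → ℝ)) (hρ : ContDiff ℝ (⊤ : ℕ∞) ρ)
    (hnd : ∃ U : Set (Fin n → ℝ), IsOpen U ∧ ρ ⁻¹' {0} ⊆ U ∧
      ∀ x ∈ U, Function.Surjective (fderiv ℝ ρ x))
    (hgfi : ∀ x ∈ ρ ⁻¹' {0}, ∀ v : Fin n → ℝ,
      (∀ γ, θ γ x v = 0) → fderiv ℝ ρ x v = 0) :
    ∀ p ∈ ρ ⁻¹' {0}, ∃ U : Set (Fin n → ℝ), IsOpen U ∧ p ∈ U ∧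
      ∃ ψ : Fin d → Fin d → (Fin n → ℝ) → ((Fin n → ℝ) →L[ℝ] ℝ),
      ∃ bc : Fin d → Fin s → (Fin n → ℝ) → ℝ,
        (∀ μ lam, ContDiffOn ℝ (⊤ : ℕ∞) (ψ μ lam) U) ∧
        (∀ μ γ, ContDiffOn ℝ (⊤ : ℕ∞) (bc μ γ) U) ∧
        ∀ x ∈ U, ∀ μ : Fin d, ∀ v : Fin n → ℝ,
          fderiv ℝ ρ x v μ =
            (∑ lam, ρ x lam * ψ μ lam x v) + ∑ γ, bc μ γ x * θ γ x v := by
  classical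
  intro p hp
  obtain ⟨U₀, -, hU₀, hsurj⟩ := hnd
  let T : (Fin n → ℝ) → ((Fin n → ℝ) →L[ℝ] (Fin s → ℝ)) :=
    fun x => ContinuousLinearMap.pi (fun γ => θ γ x)
  have hT : ContDiff ℝ (⊤ : ℕ∞) T := by
    rw [contDiff_clm_apply_iff]
    intro v
    rw [contDiff_pi]
    intro γ
    exact (hθ γ).clm_apply contDiff_const
  obtain ⟨R, hR⟩ := (T p).exists_rightInverse_of_surjective
    (LinearMap.range_eq_top.2 (aux_surj _ (hθind p)))
  let M : (Fin n → ℝ) → ((Fin s → ℝ) →L[ℝ] (Fin s → ℝ)) := fun x => (T x).comp R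
  have hM : ContDiff ℝ (⊤ : ℕ∞) M := hT.clm_comp contDiff_const
  have hMinv : ∀ᶠ x in nhds p, (M x).IsInvertible := by
    have h1 : M p = ((ContinuousLinearEquiv.refl ℝ (Fin s → ℝ)) :
      (Fin s → ℝ) →L[ℝ] (Fin s → ℝ)) := hR
    have := ContinuousLinearEquiv.nhds (ContinuousLinearEquiv.refl ℝ (Fin s → ℝ))
    rw [← h1] at this
    exact hM.continuous.continuousAt.eventually this
  let B : (Fin n → ℝ) → ((Fin s → ℝ) →L[ℝ] (Fin d → ℝ)) :=
    fun x => (fderiv ℝ ρ x).comp (R.comp (M x).inverse)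
  have hD : ContDiff ℝ (⊤ : ℕ∞) (fderiv ℝ ρ) := hρ.fderiv_right (by simp)
  have hB : ∀ x, (M x).IsInvertible → ContDiffAt ℝ (⊤ : ℕ∞) B x := fun x hx =>
    hD.contDiffAt.clm_comp (contDiffAt_const.clm_comp
      (hx.contDiffAt_map_inverse.comp x hM.contDiffAt))
  let P : (Fin n → ℝ) → ((Fin n → ℝ) →L[ℝ] (Fin d → ℝ)) :=
    fun x => fderiv ℝ ρ x - (B x).comp (T x)
  obtain ⟨G, hG, hGe⟩ := aux_hadamard ρ hρ p (hsurj p (hU₀ hp)) P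
    (hMinv.mono fun x hx => hD.contDiffAt.sub ((hB x hx).clm_comp hT.contDiffAt))
    (hMinv.mono fun x hx h0 => by
      ext1 v
      have h1 := hgfi x h0 (v - R ((M x).inverse (T x v))) (by
        have h2 : M x ((M x).inverse (T x v)) = T x v := by
          obtain ⟨e, he⟩ := hx
          rw [← he]
          simp
        intro γ
        have h3 : T x (R ((M x).inverse (T x v))) γ = T x v γ := congrFun h2 γ
        have h4 : θ γ x (R ((M x).inverse (T x v))) = θ γ x v := h3
        rw [map_sub, h4, sub_self])
      rw [map_sub] at h1
      exact h1)
  obtain ⟨U, hU, hUo, hpU⟩ := eventually_nhds_iff.1 (hGe.and hMinv)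
  refine ⟨U, hUo, hpU, fun μ i x => (ContinuousLinearMap.proj μ).comp (G i x),
    fun μ γ x => B x (Pi.single γ 1) μ, fun μ i => ?_, fun μ γ => ?_, fun x hx μ v => ?_⟩
  · exact (contDiff_const.clm_comp (hG i)).contDiffOn
  · intro x hx
    refine ContDiffAt.contDiffWithinAt ?_
    exact contDiffAt_pi.1 ((hB x (hU x hx).2).clm_apply contDiffAt_const) μ
  · have h1 := congrFun (DFunLike.congr_fun (hU x hx).1 v) μ
    have h2 : fderiv ℝ ρ x v μ - B x (T x v) μ = ∑ i, ρ x i * G i x v μ := by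
      simpa [P] using h1
    have h3 : B x (T x v) μ = ∑ γ, B x (Pi.single γ 1) μ * θ γ x v := by
      conv_lhs => rw [pi_eq_sum_univ' (T x v)]
      simp [T, map_sum, mul_comm]
    rw [← h3]
    exact sub_eq_iff_eq_add.1 h2
end
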